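/- For every integer p ≥ 5, B(p,3) is isomorphic to the group presented by generators u, v, w and A_{1,i}, A_{2,i} for 2 ≤ i ≤ p−1, with relators all commutators [α(i), β(j)], [β(i), γ(j)], [γ(i), δ(j)] and [δ(i), α(j)] for i,j ∈ {1,…,p−3} with i+j > p−3, where α, β, γ, δ are the following words in the free group on the generators (with the conventions A_{1,p} = 1 and A_{2,1} = 1): α(i) := A_{2,p−i−1} A_{2,p−i−2}⁻¹ for 1 ≤ i ≤ p−3; β(p−3) := w⁻¹ A_{1,2} v and β(i) := v⁻¹ A_{1,p−i−2}⁻¹ A_{1,p−i−1} v for 1 ≤ i ≤ p−4; γ(i) := A_{1,i+2}⁻¹ A_{1,i+3} for 1 ≤ i ≤ p−3; δ(p−3) := v A_{2,p−1} u and δ(i) := v A_{2,i+3} A_{2,i+2}⁻¹ v⁻¹ for 1 ≤ i ≤ p−4. Here [x,y] denotes the commutator x y x⁻¹ y⁻¹. -/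

import Mathlib

/-- Generators of the presentation of `B(p,q)`: triples `(t, ℓ, i)` with `t ∈ Fin 3`
(`t = 0` for `a`, `t = 1` for `b`, `t = 2` for `c`), `1 ≤ ℓ ≤ q - 1`, `1 ≤ i ≤ p - 1`. -/
def BGen (p q : ℕ) : Type :=
  {x : Fin 3 × ℕ × ℕ // 1 ≤ x.2.1 ∧ x.2.1 ≤ q - 1 ∧ 1 ≤ x.2.2 ∧ x.2.2 ≤ p - 1}

/-- The generator `a_{ℓ,i}` (as an element of the free group), or `1` if out of range. -/
def ga (p q ℓ i : ℕ) : FreeGroup (BGen p q) :=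
  if h : 1 ≤ ℓ ∧ ℓ ≤ q - 1 ∧ 1 ≤ i ∧ i ≤ p - 1 then FreeGroup.of ⟨(0, ℓ, i), h⟩ else 1

/-- The generator `b_{ℓ,i}`, or `1` if out of range. -/
def gb (p q ℓ i : ℕ) : FreeGroup (BGen p q) :=
  if h : 1 ≤ ℓ ∧ ℓ ≤ q - 1 ∧ 1 ≤ i ∧ i ≤ p - 1 then FreeGroup.of ⟨(1, ℓ, i), h⟩ else 1

/-- The generator `c_{ℓ,i}`, or `1` if out of range. -/
def gc (p q ℓ i : ℕ) : FreeGroup (BGen p q) :=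
  if h : 1 ≤ ℓ ∧ ℓ ≤ q - 1 ∧ 1 ≤ i ∧ i ≤ p - 1 then FreeGroup.of ⟨(2, ℓ, i), h⟩ else 1

/-- The commutator `[x, y] = x * y * x⁻¹ * y⁻¹`. -/
def gcomm {G : Type*} [Group G] (x y : G) : G := x * y * x⁻¹ * y⁻¹

/-- The relators (R1)–(R5) of the presentation of `B(p,q)`. -/
def Brels (p q : ℕ) : Set (FreeGroup (BGen p q)) :=
  {r | r = ga p q 1 1 ∨ r = gc p q (q - 1) 1
    ∨ (∃ ℓ i j, 1 ≤ ℓ ∧ ℓ ≤ q - 1 ∧ 1 ≤ i ∧ i < j ∧ j ≤ p - 1 ∧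
        r = gb p q ℓ i * ga p q ℓ j * (gb p q ℓ i)⁻¹ * (gc p q ℓ j)⁻¹)
    ∨ (∃ ℓ i j, 1 ≤ ℓ ∧ ℓ ≤ q - 2 ∧ 1 ≤ i ∧ i ≤ p - 1 ∧ 1 ≤ j ∧ j ≤ p - i ∧
        r = gc p q ℓ i * ga p q (ℓ + 1) j * (gb p q ℓ i)⁻¹ * (gb p q (ℓ + 1) j)⁻¹)
    ∨ (∃ ℓ i j, 1 ≤ ℓ ∧ ℓ ≤ q - 2 ∧ 3 ≤ i ∧ i ≤ p - 1 ∧ 3 ≤ j ∧ j ≤ p - 1 ∧ p + 2 ≤ i + j ∧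
        r = gcomm (gc p q ℓ i) (ga p q (ℓ + 1) j))
    ∨ (∃ ℓ lam i j, 2 ≤ ℓ + 1 ∧ ℓ + 1 < lam ∧ lam ≤ q - 1 ∧
        1 ≤ i ∧ i ≤ p - 1 ∧ 1 ≤ j ∧ j ≤ p - 1 ∧
        r = gcomm (gc p q ℓ i) (ga p q lam j))}

/-- The square-section braid group `B(p,q) = B_{pq-2}(p × q)`, via its presentation. -/
abbrev B (p q : ℕ) : Type := PresentedGroup (Brels p q)

/-- Generators of the presentation of `B(p,3)` from the paper's Section 5:
`Sum.inl 0 = u`, `Sum.inl 1 = v`, `Sum.inl 2 = w`, and `Sum.inr ⟨(k, i), _⟩ = A_{k+1,i}`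
for `k ∈ Fin 2` and `2 ≤ i ≤ p - 1`. -/
def GGen (p : ℕ) : Type :=
  Fin 3 ⊕ {x : Fin 2 × ℕ // 2 ≤ x.2 ∧ x.2 ≤ p - 1}

/-- The generator `u`. -/
def gu (p : ℕ) : FreeGroup (GGen p) := FreeGroup.of (Sum.inl 0)
/-- The generator `v`. -/
def gv (p : ℕ) : FreeGroup (GGen p) := FreeGroup.of (Sum.inl 1)
/-- The generator `w`. -/
def gw (p : ℕ) : FreeGroup (GGen p) := FreeGroup.of (Sum.inl 2)

/-- The generator `A_{1,i}`, with the convention that out-of-range indices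
(in particular `A_{1,p}`) give `1`. -/
def gA1 (p i : ℕ) : FreeGroup (GGen p) :=
  if h : 2 ≤ i ∧ i ≤ p - 1 then FreeGroup.of (Sum.inr ⟨(0, i), h⟩) else 1

/-- The generator `A_{2,i}`, with the convention that out-of-range indices
(in particular `A_{2,1}`) give `1`. -/
def gA2 (p i : ℕ) : FreeGroup (GGen p) :=
  if h : 2 ≤ i ∧ i ≤ p - 1 then FreeGroup.of (Sum.inr ⟨(1, i), h⟩) else 1

/-- The relators of the presentation of `B(p,3)` by generators `u, v, w, A_{1,i}, A_{2,i}`. -/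
def Grels (p : ℕ) : Set (FreeGroup (GGen p)) :=
  {r | (∃ i j, 2 ≤ i ∧ i < j ∧ j ≤ p - 1 ∧
        r = gcomm ((gw p)⁻¹ * gA1 p i * gv p) (gA1 p j))
    ∨ (∃ i j, 2 ≤ i ∧ i ≤ p - 2 ∧ 2 ≤ j ∧ j ≤ p - i ∧
        r = gcomm ((gw p)⁻¹ * gA1 p i * gv p) (gA2 p j))
    ∨ (∃ i j, 2 ≤ i ∧ i < j ∧ j ≤ p - 1 ∧
        r = gcomm (gv p * gA2 p j * gu p) (gA2 p i))
    ∨ (∃ i j, 3 ≤ i ∧ i ≤ p - 1 ∧ 3 ≤ j ∧ j ≤ p - 1 ∧ p + 2 ≤ i + j ∧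
        r = gcomm (gv p * gA2 p j * gu p) (gA1 p i))}

/-- The word `α(i) = A_{2,p-i-1} A_{2,p-i-2}⁻¹` (convention `A_{2,1} = 1`). -/
def walpha (p i : ℕ) : FreeGroup (GGen p) := gA2 p (p - i - 1) * (gA2 p (p - i - 2))⁻¹

/-- The word `β(i)`: `β(p-3) = w⁻¹ A_{1,2} v` and
`β(i) = v⁻¹ A_{1,p-i-2}⁻¹ A_{1,p-i-1} v` for `1 ≤ i ≤ p-4`. -/
def wbeta (p i : ℕ) : FreeGroup (GGen p) :=
  if i = p - 3 then (gw p)⁻¹ * gA1 p 2 * gv p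
  else (gv p)⁻¹ * (gA1 p (p - i - 2))⁻¹ * gA1 p (p - i - 1) * gv p

/-- The word `γ(i) = A_{1,i+2}⁻¹ A_{1,i+3}` (convention `A_{1,p} = 1`). -/
def wgamma (p i : ℕ) : FreeGroup (GGen p) := (gA1 p (i + 2))⁻¹ * gA1 p (i + 3)

/-- The word `δ(i)`: `δ(p-3) = v A_{2,p-1} u` and
`δ(i) = v A_{2,i+3} A_{2,i+2}⁻¹ v⁻¹` for `1 ≤ i ≤ p-4`. -/
def wdelta (p i : ℕ) : FreeGroup (GGen p) :=
  if i = p - 3 then gv p * gA2 p (p - 1) * gu p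
  else gv p * gA2 p (i + 3) * (gA2 p (i + 2))⁻¹ * (gv p)⁻¹

/-- The relators `[α(i),β(j)]`, `[β(i),γ(j)]`, `[γ(i),δ(j)]`, `[δ(i),α(j)]` for
`i, j ∈ {1, …, p-3}` with `i + j > p - 3`. -/
def ABCDrels (p : ℕ) : Set (FreeGroup (GGen p)) :=
  {r | ∃ i j, 1 ≤ i ∧ i ≤ p - 3 ∧ 1 ≤ j ∧ j ≤ p - 3 ∧ p - 3 < i + j ∧
      (r = gcomm (walpha p i) (wbeta p j) ∨ r = gcomm (wbeta p i) (wgamma p j)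
        ∨ r = gcomm (wgamma p i) (wdelta p j) ∨ r = gcomm (wdelta p i) (walpha p j))}

theorem gcomm_eq_one_iff {G : Type*} [Group G] (x y : G) : gcomm x y = 1 ↔ Commute x y := by
  rw [gcomm, mul_inv_eq_one, mul_inv_eq_iff_eq_mul]
  rfl

theorem map_gcomm {G H : Type*} [Group G] [Group H] (φ : G →* H) (x y : G) :
    φ (gcomm x y) = gcomm (φ x) (φ y) := by
  simp [gcomm]

/-- The elements of `G` whose image under `φ` commutes with `y`. -/
def commutingWith {G H : Type*} [Group G] [Group H] (φ : G →* H) (y : H) : Subgroup G :=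
  (Subgroup.centralizer {y}).comap φ

theorem mem_commutingWith {G H : Type*} [Group G] [Group H] (φ : G →* H) (y : H) (x : G) :
    x ∈ commutingWith φ y ↔ Commute (φ x) y := by
  rw [commutingWith, Subgroup.mem_comap, Subgroup.mem_centralizer_singleton_iff]
  rfl

/-- If `s` lies in every subgroup containing all `x i` with `P i`, and `t` in every subgroup
containing all `y j` with `Q j`, then `φ s` and `φ t` commute as soon as all `φ (x i)` and
`φ (y j)` do. -/
theorem commute_of_mem_of_mem {G H : Type*} [Group G] [Group H] (φ : G →* H) {s t : G}
    {x y : ℕ → G} {P Q : ℕ → Prop}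
    (hs : ∀ K : Subgroup G, (∀ i, P i → x i ∈ K) → s ∈ K)
    (ht : ∀ K : Subgroup G, (∀ j, Q j → y j ∈ K) → t ∈ K)
    (h : ∀ i j, P i → Q j → Commute (φ (x i)) (φ (y j))) : Commute (φ s) (φ t) := by
  rw [← mem_commutingWith]
  refine hs _ fun i hi => ?_
  rw [mem_commutingWith]
  refine Commute.symm ?_
  rw [← mem_commutingWith]
  refine ht _ fun j hj => ?_
  rw [mem_commutingWith]
  exact (h i j hi hj).symm

section Words

variable {p : ℕ} (K : Subgroup (FreeGroup (GGen p)))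

theorem gA1_of_le {p i : ℕ} (hp : 1 ≤ p) (h : p ≤ i) : gA1 p i = 1 :=
  dif_neg (by omega)

theorem gA2_of_lt {i : ℕ} (h : i < 2) : gA2 p i = 1 :=
  dif_neg (by omega)

theorem gA2_mem_of_walpha_mem {k : ℕ} (hk : 2 ≤ k) (hkp : k ≤ p - 2)
    (h : ∀ i, p - 1 - k ≤ i ∧ i ≤ p - 3 → walpha p i ∈ K) : gA2 p k ∈ K := by
  induction k, hk using Nat.le_induction with
  | base =>
    have := h (p - 3) (by omega)
    rwa [walpha, show p - (p - 3) - 1 = 2 by omega, show p - (p - 3) - 2 = 1 by omega,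
      gA2_of_lt (i := 1) (by omega), inv_one, mul_one] at this
  | succ k hk ih =>
    have h1 := h (p - 2 - k) (by omega)
    rw [walpha, show p - (p - 2 - k) - 1 = k + 1 by omega,
      show p - (p - 2 - k) - 2 = k by omega] at h1
    simpa using K.mul_mem h1 (ih (by omega) fun i hi => h i (by omega))

theorem walpha_mem_of_gA2_mem {i : ℕ} (hi : 1 ≤ i) (hip : i ≤ p - 3)
    (h : ∀ k, 2 ≤ k ∧ k ≤ p - 1 - i → gA2 p k ∈ K) : walpha p i ∈ K := by
  refine K.mul_mem (h _ (by omega)) (K.inv_mem ?_)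
  by_cases h2 : 2 ≤ p - i - 2
  · exact h _ (by omega)
  · rw [gA2_of_lt (by omega)]
    exact K.one_mem

theorem conj_gA1_mem_of_wbeta_mem {k : ℕ} (hk : 2 ≤ k) (hkp : k ≤ p - 2)
    (h : ∀ i, p - 1 - k ≤ i ∧ i ≤ p - 3 → wbeta p i ∈ K) :
    (gw p)⁻¹ * gA1 p k * gv p ∈ K := by
  induction k, hk using Nat.le_induction with
  | base =>
    have := h (p - 3) (by omega)
    rwa [wbeta, if_pos rfl] at this
  | succ k hk ih =>
    have h1 := h (p - 2 - k) (by omega)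
    rw [wbeta, if_neg (by omega), show p - (p - 2 - k) - 1 = k + 1 by omega,
      show p - (p - 2 - k) - 2 = k by omega] at h1
    simpa [mul_assoc] using K.mul_mem (ih (by omega) fun i hi => h i (by omega)) h1

theorem wbeta_mem_of_conj_gA1_mem {i : ℕ} (hi : 1 ≤ i) (hip : i ≤ p - 3)
    (h : ∀ k, 2 ≤ k ∧ k ≤ p - 1 - i → (gw p)⁻¹ * gA1 p k * gv p ∈ K) : wbeta p i ∈ K := by
  rw [wbeta]
  split_ifs with hip'
  · exact h 2 (by omega)
  · have h1 := K.mul_mem (K.inv_mem (h (p - i - 2) (by omega))) (h (p - i - 1) (by omega))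
    simpa [mul_assoc] using h1

theorem gA1_mem_of_wgamma_mem {k : ℕ} (hk : 3 ≤ k) (hkp : k ≤ p)
    (h : ∀ i, k - 2 ≤ i ∧ i ≤ p - 3 → wgamma p i ∈ K) : gA1 p k ∈ K := by
  induction hkp using Nat.decreasingInduction with
  | self =>
    rw [gA1_of_le (by omega) le_rfl]
    exact K.one_mem
  | of_succ k hkp ih =>
    have h1 := h (k - 2) (by omega)
    rw [wgamma, show k - 2 + 2 = k by omega, show k - 2 + 3 = k + 1 by omega] at h1
    simpa using K.mul_mem (ih (by omega) fun i hi => h i (by omega)) (K.inv_mem h1)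

theorem wgamma_mem_of_gA1_mem {i : ℕ} (hi : 1 ≤ i) (hip : i ≤ p - 3)
    (h : ∀ k, i + 2 ≤ k ∧ k ≤ p - 1 → gA1 p k ∈ K) : wgamma p i ∈ K := by
  refine K.mul_mem (K.inv_mem (h _ (by omega))) ?_
  by_cases h2 : i + 3 ≤ p - 1
  · exact h _ (by omega)
  · rw [gA1_of_le (by omega) (by omega)]
    exact K.one_mem

theorem conj_gA2_mem_of_wdelta_mem {k : ℕ} (hk : 3 ≤ k) (hkp : k ≤ p - 1)
    (h : ∀ i, k - 2 ≤ i ∧ i ≤ p - 3 → wdelta p i ∈ K) : gv p * gA2 p k * gu p ∈ K := by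
  induction hkp using Nat.decreasingInduction with
  | self =>
    have := h (p - 3) (by omega)
    rwa [wdelta, if_pos rfl] at this
  | of_succ k hkp ih =>
    have h1 := h (k - 2) (by omega)
    rw [wdelta, if_neg (by omega), show k - 2 + 2 = k by omega,
      show k - 2 + 3 = k + 1 by omega] at h1
    simpa [mul_assoc] using K.mul_mem (K.inv_mem h1) (ih (by omega) fun i hi => h i (by omega))

theorem wdelta_mem_of_conj_gA2_mem {i : ℕ} (hi : 1 ≤ i) (hip : i ≤ p - 3)
    (h : ∀ k, i + 2 ≤ k ∧ k ≤ p - 1 → gv p * gA2 p k * gu p ∈ K) : wdelta p i ∈ K := by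
  rw [wdelta]
  split_ifs with hip'
  · exact h _ (by omega)
  · have h1 := K.mul_mem (h (i + 3) (by omega)) (K.inv_mem (h (i + 2) (by omega)))
    simpa [mul_assoc] using h1

end Words

/-- The relators `Grels p` hold in any quotient in which the relators `ABCDrels p` hold. -/
theorem map_Grels_eq_one {p : ℕ} {H : Type*} [Group H] (φ : FreeGroup (GGen p) →* H)
    (h : ∀ r ∈ ABCDrels p, φ r = 1) : ∀ r ∈ Grels p, φ r = 1 := by
  have comm : ∀ {x y : FreeGroup (GGen p)}, gcomm x y ∈ ABCDrels p → Commute (φ x) (φ y) :=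
    fun hr => by rw [← gcomm_eq_one_iff, ← map_gcomm]; exact h _ hr
  rintro r (⟨i, j, h1, h2, h3, rfl⟩ | ⟨i, j, h1, h2, h3, h4, rfl⟩ | ⟨i, j, h1, h2, h3, rfl⟩ |
    ⟨i, j, h1, h2, h3, h4, h5, rfl⟩) <;> rw [map_gcomm, gcomm_eq_one_iff]
  · exact commute_of_mem_of_mem φ (fun K => conj_gA1_mem_of_wbeta_mem K h1 (by omega))
      (fun K => gA1_mem_of_wgamma_mem K (by omega) (by omega)) fun k l hk hl =>
        comm ⟨k, l, by omega, by omega, by omega, by omega, by omega, .inr (.inl rfl)⟩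
  · exact commute_of_mem_of_mem φ (fun K => conj_gA1_mem_of_wbeta_mem K h1 (by omega))
      (fun K => gA2_mem_of_walpha_mem K h3 (by omega)) fun k l hk hl => Commute.symm <|
        comm ⟨l, k, by omega, by omega, by omega, by omega, by omega, .inl rfl⟩
  · exact commute_of_mem_of_mem φ (fun K => conj_gA2_mem_of_wdelta_mem K (by omega) h3)
      (fun K => gA2_mem_of_walpha_mem K h1 (by omega)) fun k l hk hl =>
        comm ⟨k, l, by omega, by omega, by omega, by omega, by omega, .inr (.inr (.inr rfl))⟩
  · exact commute_of_mem_of_mem φ (fun K => conj_gA2_mem_of_wdelta_mem K h3 h4)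
      (fun K => gA1_mem_of_wgamma_mem K h1 (by omega)) fun k l hk hl => Commute.symm <|
        comm ⟨l, k, by omega, by omega, by omega, by omega, by omega, .inr (.inr (.inl rfl))⟩

/-- The relators `ABCDrels p` hold in any quotient in which the relators `Grels p` hold. -/
theorem map_ABCDrels_eq_one {p : ℕ} {H : Type*} [Group H] (φ : FreeGroup (GGen p) →* H)
    (h : ∀ r ∈ Grels p, φ r = 1) : ∀ r ∈ ABCDrels p, φ r = 1 := by
  have comm : ∀ {x y : FreeGroup (GGen p)}, gcomm x y ∈ Grels p → Commute (φ x) (φ y) :=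
    fun hr => by rw [← gcomm_eq_one_iff, ← map_gcomm]; exact h _ hr
  rintro r ⟨i, j, h1, h2, h3, h4, h5, rfl | rfl | rfl | rfl⟩ <;>
    rw [map_gcomm, gcomm_eq_one_iff]
  · exact commute_of_mem_of_mem φ (fun K => walpha_mem_of_gA2_mem K h1 h2)
      (fun K => wbeta_mem_of_conj_gA1_mem K h3 h4) fun k l hk hl => Commute.symm <|
        comm <| .inr <| .inl ⟨l, k, by omega, by omega, by omega, by omega, rfl⟩
  · exact commute_of_mem_of_mem φ (fun K => wbeta_mem_of_conj_gA1_mem K h1 h2)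
      (fun K => wgamma_mem_of_gA1_mem K h3 h4) fun k l hk hl =>
        comm <| .inl ⟨k, l, by omega, by omega, by omega, rfl⟩
  · exact commute_of_mem_of_mem φ (fun K => wgamma_mem_of_gA1_mem K h1 h2)
      (fun K => wdelta_mem_of_conj_gA2_mem K h3 h4) fun k l hk hl => Commute.symm <|
        comm <| .inr <| .inr <| .inr
          ⟨k, l, by omega, by omega, by omega, by omega, by omega, rfl⟩
  · exact commute_of_mem_of_mem φ (fun K => wdelta_mem_of_conj_gA2_mem K h1 h2)
      (fun K => walpha_mem_of_gA2_mem K h3 h4) fun k l hk hl =>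
        comm <| .inr <| .inr <| .inl ⟨l, k, by omega, by omega, by omega, rfl⟩

theorem map_eq_of_mem_Brels {p : ℕ} {H : Type*} [Group H] (φ : FreeGroup (BGen p 3) →* H)
    (h : ∀ r ∈ Brels p 3, φ r = 1) :
    φ (ga p 3 1 1) = 1 ∧ φ (gc p 3 2 1) = 1 ∧
    (∀ ℓ i j, 1 ≤ ℓ → ℓ ≤ 2 → 1 ≤ i → i < j → j ≤ p - 1 →
      φ (gb p 3 ℓ i) * φ (ga p 3 ℓ j) * (φ (gb p 3 ℓ i))⁻¹ = φ (gc p 3 ℓ j)) ∧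
    (∀ i j, 1 ≤ i → i ≤ p - 1 → 1 ≤ j → j ≤ p - i →
      φ (gc p 3 1 i) * φ (ga p 3 2 j) = φ (gb p 3 2 j) * φ (gb p 3 1 i)) ∧
    ∀ i j, 3 ≤ i → i ≤ p - 1 → 3 ≤ j → j ≤ p - 1 → p + 2 ≤ i + j →
      Commute (φ (gc p 3 1 i)) (φ (ga p 3 2 j)) := by
  refine ⟨h _ (.inl rfl), h _ (.inr (.inl rfl)), fun ℓ i j h1 h2 h3 h4 h5 => ?_,
    fun i j h1 h2 h3 h4 => ?_, fun i j h1 h2 h3 h4 h5 => ?_⟩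
  · have := h _ (.inr (.inr (.inl ⟨ℓ, i, j, h1, h2, h3, h4, h5, rfl⟩)))
    simpa [mul_inv_eq_one] using this
  · have := h _ (.inr (.inr (.inr (.inl ⟨1, i, j, le_rfl, le_rfl, h1, h2, h3, h4, rfl⟩))))
    simpa [mul_inv_eq_one, mul_inv_eq_iff_eq_mul] using this
  · have := h _ (.inr (.inr (.inr (.inr (.inl
      ⟨1, i, j, le_rfl, le_rfl, h1, h2, h3, h4, h5, rfl⟩)))))
    rwa [map_gcomm, gcomm_eq_one_iff] at this

/-- The word in the generators of `B(p,3)` representing a generator of the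
`u, v, w, A` presentation. -/
def GGen.toBWord {p : ℕ} : GGen p → FreeGroup (BGen p 3)
  | .inl 0 => gb p 3 1 1
  | .inl 1 => (gb p 3 1 1)⁻¹ * ga p 3 2 1
  | .inl 2 => (gb p 3 1 1)⁻¹ * gc p 3 1 1 * ga p 3 2 1
  | .inr ⟨(0, i), _⟩ => ga p 3 1 i
  | .inr ⟨(1, i), _⟩ => (ga p 3 2 1)⁻¹ * ga p 3 2 i

/-- The word in `u, v, w, A` representing `a_{ℓ,i}`, `b_{ℓ,i}` or `c_{ℓ,i}`. -/
def abcWord (p : ℕ) (t : Fin 3) (ℓ i : ℕ) : FreeGroup (GGen p) :=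
  match t with
  | 0 => if ℓ = 1 then gA1 p i else gu p * gv p * gA2 p i
  | 1 => if ℓ = 1 then (if i = 1 then gu p else gu p * (gw p)⁻¹ * gA1 p i * gv p)
      else gu p * gw p * gA2 p i * (gu p)⁻¹
  | 2 => if ℓ = 1 then
        (if i = 1 then gu p * gw p * (gv p)⁻¹ * (gu p)⁻¹ else gu p * gA1 p i * (gu p)⁻¹)
      else (if i = 1 then 1 else gu p * gw p * gv p * gA2 p i * gu p * (gw p)⁻¹ * (gu p)⁻¹)

section Lifts

variable {p : ℕ} {H : Type*} [Group H]

/-- The homomorphism from the free group on the generators of `B(p,3)` induced by a homomorphism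
from the free group on `u, v, w, A`. -/
def liftABC (φ : FreeGroup (GGen p) →* H) : FreeGroup (BGen p 3) →* H :=
  FreeGroup.lift fun x => φ (abcWord p x.1.1 x.1.2.1 x.1.2.2)

theorem liftABC_ga (φ : FreeGroup (GGen p) →* H) {ℓ i : ℕ} (hℓ : 1 ≤ ℓ) (hℓ' : ℓ ≤ 2)
    (hi : 1 ≤ i) (hi' : i ≤ p - 1) : liftABC φ (ga p 3 ℓ i) = φ (abcWord p 0 ℓ i) := by
  rw [ga, dif_pos ⟨hℓ, hℓ', hi, hi'⟩]
  exact FreeGroup.lift_apply_of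

theorem liftABC_gb (φ : FreeGroup (GGen p) →* H) {ℓ i : ℕ} (hℓ : 1 ≤ ℓ) (hℓ' : ℓ ≤ 2)
    (hi : 1 ≤ i) (hi' : i ≤ p - 1) : liftABC φ (gb p 3 ℓ i) = φ (abcWord p 1 ℓ i) := by
  rw [gb, dif_pos ⟨hℓ, hℓ', hi, hi'⟩]
  exact FreeGroup.lift_apply_of

theorem liftABC_gc (φ : FreeGroup (GGen p) →* H) {ℓ i : ℕ} (hℓ : 1 ≤ ℓ) (hℓ' : ℓ ≤ 2)
    (hi : 1 ≤ i) (hi' : i ≤ p - 1) : liftABC φ (gc p 3 ℓ i) = φ (abcWord p 2 ℓ i) := by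
  rw [gc, dif_pos ⟨hℓ, hℓ', hi, hi'⟩]
  exact FreeGroup.lift_apply_of

/-- The homomorphism from the free group on `u, v, w, A` induced by a homomorphism from the free
group on the generators of `B(p,3)`. -/
def liftUVW (φ : FreeGroup (BGen p 3) →* H) : FreeGroup (GGen p) →* H :=
  FreeGroup.lift fun x => φ x.toBWord

theorem liftUVW_gu (φ : FreeGroup (BGen p 3) →* H) : liftUVW φ (gu p) = φ (gb p 3 1 1) :=
  FreeGroup.lift_apply_of

theorem liftUVW_gv (φ : FreeGroup (BGen p 3) →* H) :
    liftUVW φ (gv p) = (φ (gb p 3 1 1))⁻¹ * φ (ga p 3 2 1) := by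
  rw [← map_inv, ← map_mul]
  exact FreeGroup.lift_apply_of

theorem liftUVW_gw (φ : FreeGroup (BGen p 3) →* H) :
    liftUVW φ (gw p) = (φ (gb p 3 1 1))⁻¹ * φ (gc p 3 1 1) * φ (ga p 3 2 1) := by
  rw [← map_inv, ← map_mul, ← map_mul]
  exact FreeGroup.lift_apply_of

theorem liftUVW_gA1 (φ : FreeGroup (BGen p 3) →* H) {i : ℕ} (hi : 2 ≤ i) (hi' : i ≤ p - 1) :
    liftUVW φ (gA1 p i) = φ (ga p 3 1 i) := by
  rw [gA1, dif_pos ⟨hi, hi'⟩]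
  exact FreeGroup.lift_apply_of

theorem liftUVW_gA2 (φ : FreeGroup (BGen p 3) →* H) {i : ℕ} (hi : 1 ≤ i) (hi' : i ≤ p - 1) :
    liftUVW φ (gA2 p i) = (φ (ga p 3 2 1))⁻¹ * φ (ga p 3 2 i) := by
  obtain rfl | h := hi.eq_or_lt
  · rw [gA2_of_lt (by omega), map_one, inv_mul_cancel]
  · rw [gA2, dif_pos ⟨h, hi'⟩, ← map_inv, ← map_mul]
    exact FreeGroup.lift_apply_of

/-- The relators of `B(p,3)` hold for the words `abcWord` wherever `Grels p` holds. -/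
theorem liftABC_eq_one (hp : 5 ≤ p) (φ : FreeGroup (GGen p) →* H)
    (h : ∀ r ∈ Grels p, φ r = 1) : ∀ r ∈ Brels p 3, liftABC φ r = 1 := by
  have comm : ∀ {x y : FreeGroup (GGen p)}, gcomm x y ∈ Grels p → φ x * φ y = φ y * φ x :=
    fun hr => by rw [← commute_iff_eq, ← gcomm_eq_one_iff, ← map_gcomm]; exact h _ hr
  rintro r (rfl | rfl | ⟨ℓ, i, j, h1, h2, h3, h4, h5, rfl⟩ | ⟨ℓ, i, j, h1, h2, h3, h4, h5, h6, rfl⟩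
    | ⟨ℓ, i, j, h1, h2, h3, h4, h5, h6, h7, rfl⟩ | ⟨ℓ, k, i, j, h1, h2, h3, h4, h5, h6, h7, rfl⟩)
  · rw [liftABC_ga φ le_rfl (by omega) le_rfl (by omega)]
    simp [abcWord, gA1]
  · rw [liftABC_gc φ (by omega) (by omega) le_rfl (by omega)]
    simp [abcWord]
  · have hj : j ≠ 1 := by omega
    rw [map_mul, map_mul, map_mul, map_inv, map_inv, liftABC_ga φ h1 h2 (by omega) h5,
      liftABC_gb φ h1 h2 h3 (by omega), liftABC_gc φ h1 h2 (by omega) h5, mul_inv_eq_one,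
      mul_inv_eq_iff_eq_mul]
    obtain rfl | rfl : ℓ = 1 ∨ ℓ = 2 := by omega
    · obtain rfl | hi := h3.eq_or_lt
      · simp [abcWord, hj]
      · have e := comm (.inl ⟨i, j, hi, h4, h5, rfl⟩)
        simpa [abcWord, hj, hi.ne', mul_assoc] using e
    · obtain rfl | hi := h3.eq_or_lt
      · simp [abcWord, hj, gA2_of_lt, mul_assoc]
      · have e := comm (.inr (.inr (.inl ⟨i, j, hi, h4, h5, rfl⟩)))
        simpa [abcWord, hj, mul_assoc, eq_mul_inv_iff_mul_eq] using
          congrArg (fun z => z * (φ (gu p))⁻¹) e.symm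
  · obtain rfl : ℓ = 1 := by omega
    rw [map_mul, map_mul, map_mul, map_inv, map_inv,
      liftABC_ga φ (by omega) (by omega) (by omega) (by omega),
      liftABC_gb φ le_rfl (by omega) h3 (by omega),
      liftABC_gb φ (by omega) (by omega) h5 (by omega),
      liftABC_gc φ le_rfl (by omega) h3 (by omega), mul_inv_eq_one, mul_inv_eq_iff_eq_mul]
    obtain rfl | hi := h3.eq_or_lt
    · simp [abcWord, mul_assoc]
    obtain rfl | hj := h5.eq_or_lt
    · simp [abcWord, hi.ne', gA2_of_lt, mul_assoc]
    have e := comm (.inr (.inl ⟨i, j, hi, by omega, hj, h6, rfl⟩))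
    simpa [abcWord, hi.ne', mul_assoc] using congrArg (fun z => φ (gw p) * z) e
  · obtain rfl : ℓ = 1 := by omega
    rw [map_gcomm, gcomm_eq_one_iff, liftABC_ga φ (by omega) (by omega) (by omega) (by omega),
      liftABC_gc φ le_rfl (by omega) (by omega) (by omega), commute_iff_eq]
    have e := comm (.inr (.inr (.inr ⟨i, j, h3, h4, h5, h6, h7, rfl⟩)))
    have hi : i ≠ 1 := by omega
    simpa [abcWord, hi, mul_assoc] using congrArg (fun z => z * (φ (gu p))⁻¹) e.symm
  · omega

/-- The relators `Grels p` hold for the words `GGen.toBWord` wherever the relators of `B(p,3)`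
hold. -/
theorem liftUVW_eq_one (hp : 5 ≤ p) (φ : FreeGroup (BGen p 3) →* H)
    (h : ∀ r ∈ Brels p 3, φ r = 1) : ∀ r ∈ Grels p, liftUVW φ r = 1 := by
  obtain ⟨-, -, hconj, hprod, hcomm⟩ := map_eq_of_mem_Brels φ h
  have hb21 : φ (gb p 3 2 1) = φ (gc p 3 1 1) * φ (ga p 3 2 1) * (φ (gb p 3 1 1))⁻¹ :=
    eq_mul_inv_of_mul_eq (hprod 1 1 le_rfl (by omega) le_rfl (by omega)).symm
  have hw : ∀ i, 2 ≤ i → i ≤ p - 1 → liftUVW φ ((gw p)⁻¹ * gA1 p i * gv p) =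
      (φ (gb p 3 1 1))⁻¹ * φ (gb p 3 1 i) := by
    intro i hi hi'
    have e1 := hprod i 1 (by omega) hi' le_rfl (by omega)
    rw [← hconj 1 1 i le_rfl (by omega) le_rfl (by omega) hi', hb21] at e1
    simp only [mul_assoc] at e1
    simp [liftUVW_gv, liftUVW_gw, liftUVW_gA1 φ hi hi', mul_assoc, e1]
  have hv : ∀ j, 2 ≤ j → j ≤ p - 1 → liftUVW φ (gv p * gA2 p j * gu p) =
      (φ (gb p 3 1 1))⁻¹ * φ (ga p 3 2 j) * φ (gb p 3 1 1) := by
    intro j hj hj'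
    simp [liftUVW_gv, liftUVW_gu, liftUVW_gA2 φ (by omega : 1 ≤ j) hj', mul_assoc]
  rintro r (⟨i, j, h1, h2, h3, rfl⟩ | ⟨i, j, h1, h2, h3, h4, rfl⟩ | ⟨i, j, h1, h2, h3, rfl⟩ |
    ⟨i, j, h1, h2, h3, h4, h5, rfl⟩) <;> rw [map_gcomm, gcomm_eq_one_iff, commute_iff_eq]
  · rw [hw i h1 (by omega), liftUVW_gA1 φ (by omega) h3]
    have e := hconj 1 i j le_rfl (by omega) (by omega) h2 h3
    rw [← hconj 1 1 j le_rfl (by omega) le_rfl (by omega) h3, mul_inv_eq_iff_eq_mul] at e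
    simp [mul_assoc, e]
  · rw [hw i h1 (by omega), liftUVW_gA2 φ (by omega) (by omega)]
    have e1 := eq_inv_mul_of_mul_eq (hprod i 1 (by omega) (by omega) le_rfl (by omega)).symm
    have e2 := eq_mul_inv_of_mul_eq (hprod 1 j le_rfl (by omega) (by omega) (by omega)).symm
    have e3 := hprod i j (by omega) (by omega) (by omega) (by omega)
    calc _ = (φ (ga p 3 2 1))⁻¹ * (φ (gc p 3 1 1))⁻¹ * (φ (gc p 3 1 i) * φ (ga p 3 2 j)) := by
          simp [e1, hb21, mul_assoc]
      _ = _ := by simp [e3, e2, mul_assoc]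
  · rw [hv j (by omega) h3, liftUVW_gA2 φ (by omega) (by omega)]
    have e1 := hconj 2 i j (by omega) le_rfl (by omega) h2 h3
    have e2 := eq_mul_inv_of_mul_eq (hprod 1 i le_rfl (by omega) (by omega) (by omega)).symm
    rw [← hconj 2 1 j (by omega) le_rfl le_rfl (by omega) h3, e2, hb21] at e1
    simpa [mul_assoc] using congrArg (fun z => (φ (ga p 3 2 1))⁻¹ * (φ (gc p 3 1 1))⁻¹ * z *
      φ (gc p 3 1 1) * φ (ga p 3 2 i)) e1.symm
  · rw [hv j (by omega) h4, liftUVW_gA1 φ (by omega) h2]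
    have e := hcomm i j h1 h2 h3 h4 h5
    rw [← hconj 1 1 i le_rfl (by omega) le_rfl (by omega) h2, commute_iff_eq] at e
    simpa [mul_assoc] using congrArg (fun z => (φ (gb p 3 1 1))⁻¹ * z * φ (gb p 3 1 1)) e.symm

theorem liftUVW_abcWord (hp : 5 ≤ p) (φ : FreeGroup (BGen p 3) →* H)
    (h : ∀ r ∈ Brels p 3, φ r = 1) (x : BGen p 3) :
    liftUVW φ (abcWord p x.1.1 x.1.2.1 x.1.2.2) = φ (FreeGroup.of x) := by
  obtain ⟨ha11, hc21, hconj, hprod, -⟩ := map_eq_of_mem_Brels φ h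
  have hb21 : φ (gb p 3 2 1) = φ (gc p 3 1 1) * φ (ga p 3 2 1) * (φ (gb p 3 1 1))⁻¹ :=
    eq_mul_inv_of_mul_eq (hprod 1 1 le_rfl (by omega) le_rfl (by omega)).symm
  obtain ⟨⟨t, ℓ, i⟩, hx⟩ := x
  have ha : ga p 3 ℓ i = FreeGroup.of ⟨(0, ℓ, i), hx⟩ := dif_pos hx
  have hb : gb p 3 ℓ i = FreeGroup.of ⟨(1, ℓ, i), hx⟩ := dif_pos hx
  have hc : gc p 3 ℓ i = FreeGroup.of ⟨(2, ℓ, i), hx⟩ := dif_pos hx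
  have hx' : 1 ≤ ℓ ∧ ℓ ≤ 2 ∧ 1 ≤ i ∧ i ≤ p - 1 := hx
  obtain ⟨h1, h2, h3, h4⟩ := hx'
  have hA2 := liftUVW_gA2 φ h3 h4
  fin_cases t
  · change liftUVW φ (abcWord p 0 ℓ i) = φ (FreeGroup.of ⟨(0, ℓ, i), hx⟩)
    rw [← ha]
    obtain rfl | rfl : ℓ = 1 ∨ ℓ = 2 := by omega
    · obtain rfl | hi := h3.eq_or_lt
      · simp [abcWord, gA1, ha11]
      · simp [abcWord, liftUVW_gA1 φ hi h4]
    · simp [abcWord, liftUVW_gu, liftUVW_gv, hA2]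
  · change liftUVW φ (abcWord p 1 ℓ i) = φ (FreeGroup.of ⟨(1, ℓ, i), hx⟩)
    rw [← hb]
    obtain rfl | rfl : ℓ = 1 ∨ ℓ = 2 := by omega
    · obtain rfl | hi := h3.eq_or_lt
      · simp [abcWord, liftUVW_gu]
      · have e := eq_inv_mul_of_mul_eq (hprod i 1 h3 h4 le_rfl (by omega)).symm
        rw [← hconj 1 1 i le_rfl h2 le_rfl hi h4, hb21] at e
        simp [abcWord, hi.ne', liftUVW_gu, liftUVW_gv, liftUVW_gw, liftUVW_gA1 φ hi h4, e,
          mul_assoc]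
    · have e := eq_mul_inv_of_mul_eq (hprod 1 i le_rfl (by omega) h3 (by omega)).symm
      simp [abcWord, liftUVW_gu, liftUVW_gw, hA2, e, mul_assoc]
  · change liftUVW φ (abcWord p 2 ℓ i) = φ (FreeGroup.of ⟨(2, ℓ, i), hx⟩)
    rw [← hc]
    obtain rfl | rfl : ℓ = 1 ∨ ℓ = 2 := by omega
    · obtain rfl | hi := h3.eq_or_lt
      · simp [abcWord, liftUVW_gu, liftUVW_gv, liftUVW_gw, mul_assoc]
      · have e := hconj 1 1 i le_rfl h2 le_rfl hi h4
        simp [abcWord, hi.ne', liftUVW_gu, liftUVW_gA1 φ hi h4, ← e]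
    · obtain rfl | hi := h3.eq_or_lt
      · simp [abcWord, hc21]
      · have e := hconj 2 1 i h1 h2 le_rfl hi h4
        rw [hb21] at e
        simp [abcWord, hi.ne', liftUVW_gu, liftUVW_gv, liftUVW_gw, hA2, ← e, mul_assoc]

theorem liftABC_toBWord (hp : 5 ≤ p) (φ : FreeGroup (GGen p) →* H) (x : GGen p) :
    liftABC φ x.toBWord = φ (FreeGroup.of x) := by
  have ha := liftABC_ga φ (ℓ := 2) (i := 1) (by omega) le_rfl le_rfl (by omega)
  have hb := liftABC_gb φ (ℓ := 1) (i := 1) le_rfl (by omega) le_rfl (by omega)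
  have hc := liftABC_gc φ (ℓ := 1) (i := 1) le_rfl (by omega) le_rfl (by omega)
  rcases x with t | ⟨⟨t, i⟩, hi, hi'⟩ <;> fin_cases t
  · simp [GGen.toBWord, hb, abcWord, gu]
  · simp [GGen.toBWord, ha, hb, abcWord, gA2_of_lt, gv]
  · simp [GGen.toBWord, ha, hb, hc, abcWord, gA2_of_lt, gw, mul_assoc]
  · dsimp only at hi hi'
    have := liftABC_ga φ (ℓ := 1) (i := i) le_rfl (by omega) (by omega) hi'
    simp [GGen.toBWord, this, abcWord, gA1, hi, hi']
  · dsimp only at hi hi'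
    have := liftABC_ga φ (ℓ := 2) (i := i) (by omega) (by omega) (by omega) hi'
    simp [GGen.toBWord, ha, this, abcWord, gA2, hi, hi', mul_assoc]

end Lifts

/-- **Corollary (the `α, β, γ, δ` presentation of `B(p,3)`).**
For every integer `p ≥ 5`, `B(p,3)` is isomorphic to the group presented by generators
`u, v, w` and `A_{1,i}, A_{2,i}` for `2 ≤ i ≤ p-1`, with relators all the commutators
`[α(i),β(j)]`, `[β(i),γ(j)]`, `[γ(i),δ(j)]`, `[δ(i),α(j)]` for `i + j > p - 3`. -/
theorem B_p3_iso_ABCD_presentation (p : ℕ) (hp : 5 ≤ p) :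
    Nonempty (B p 3 ≃* PresentedGroup (ABCDrels p)) := by
  have hB : ∀ r ∈ Brels p 3, PresentedGroup.mk (Brels p 3) r = 1 := fun r hr =>
    PresentedGroup.one_of_mem hr
  have hG := map_Grels_eq_one (PresentedGroup.mk (ABCDrels p)) fun r hr =>
    PresentedGroup.one_of_mem hr
  let F : B p 3 →* PresentedGroup (ABCDrels p) :=
    PresentedGroup.toGroup (liftABC_eq_one hp (PresentedGroup.mk (ABCDrels p)) hG)
  let F' : PresentedGroup (ABCDrels p) →* B p 3 :=
    PresentedGroup.toGroup (map_ABCDrels_eq_one (liftUVW (PresentedGroup.mk (Brels p 3)))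
      (liftUVW_eq_one hp _ hB))
  have hF : ∀ x, F (PresentedGroup.of x) =
      PresentedGroup.mk (ABCDrels p) (abcWord p x.1.1 x.1.2.1 x.1.2.2) :=
    fun x => PresentedGroup.toGroup.of _
  have hF' : ∀ x, F' (PresentedGroup.of x) = PresentedGroup.mk (Brels p 3) x.toBWord :=
    fun x => PresentedGroup.toGroup.of _
  refine ⟨MonoidHom.toMulEquiv F F' ?_ ?_⟩
  · ext x
    exact (congrArg F' (hF x)).trans (liftUVW_abcWord hp _ hB x)
  · ext x
    exact (congrArg F (hF' x)).trans (liftABC_toBWord hp _ x)
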